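/- For every n ≥ 1, the degree-zero graded piece R_n^{(0)} = B_n/(J_n + F^1 B_n) is isomorphic, as an S_n-algebra, to the classical symmetric coinvariant algebra ℂ[x_1,…,x_n]/⟨symmetric polynomials vanishing at the origin⟩; in particular R_n^{(0)} is isomorphic as a ℂ[S_n]-module to the regular representation ℂ[S_n]. -/

import Mathlib

open MvPolynomial

set_option maxHeartbeats 1000000
set_option synthInstance.maxHeartbeats 400000

noncomputable section

/-- the ideal `(x₁y₁, …, xₙyₙ)`. -/
abbrev Bideal (n : ℕ) : Ideal (MvPolynomial (Fin n ⊕ Fin n) ℂ) :=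
  Ideal.span (Set.range fun i : Fin n => X (Sum.inl i) * X (Sum.inr i))

/-- `B n = ℂ[x₁,…,xₙ,y₁,…,yₙ]/(x₁y₁,…,xₙyₙ)`, the `n`-th tensor power of `ℂ[x,y]/(xy)`.
The variable `x_i` is `X (Sum.inl i)` and `y_i` is `X (Sum.inr i)`. -/
abbrev B (n : ℕ) : Type := MvPolynomial (Fin n ⊕ Fin n) ℂ ⧸ Bideal n

abbrev mkB (n : ℕ) : MvPolynomial (Fin n ⊕ Fin n) ℂ →ₐ[ℂ] B n :=
  Ideal.Quotient.mkₐ ℂ (Bideal n)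

def xv (n : ℕ) (i : Fin n) : B n := mkB n (X (Sum.inl i))
def yv (n : ℕ) (i : Fin n) : B n := mkB n (X (Sum.inr i))

/-- the action of a permutation `σ ∈ Sₙ` on `B n`: `σ·xᵢ = x_{σ i}`, `σ·yᵢ = y_{σ i}`. -/
def permB (n : ℕ) (σ : Equiv.Perm (Fin n)) : B n →ₐ[ℂ] B n :=
  Ideal.Quotient.liftₐ (Bideal n)
    ((mkB n).comp (MvPolynomial.rename (Sum.map ⇑σ ⇑σ)))
    (by
      intro a ha
      have h : Bideal n ≤ RingHom.ker ((mkB n).comp (MvPolynomial.rename (Sum.map ⇑σ ⇑σ))).toRingHom := by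
        rw [Ideal.span_le]
        rintro _ ⟨i, rfl⟩
        simp only [SetLike.mem_coe, RingHom.mem_ker, AlgHom.toRingHom_eq_coe, RingHom.coe_coe,
          AlgHom.comp_apply, map_mul, rename_X, Sum.map_inl, Sum.map_inr]
        rw [← map_mul, Ideal.Quotient.mkₐ_eq_mk, Ideal.Quotient.eq_zero_iff_mem]
        exact Ideal.subset_span ⟨σ i, rfl⟩
      exact h ha)

/-- evaluation at the origin. -/
def ev0 (n : ℕ) : B n →ₐ[ℂ] ℂ :=
  Ideal.Quotient.liftₐ (Bideal n) (aeval fun _ => (0 : ℂ))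
    (by
      intro a ha
      have h : Bideal n ≤ RingHom.ker (aeval (R := ℂ) fun _ : Fin n ⊕ Fin n => (0 : ℂ)).toRingHom := by
        rw [Ideal.span_le]
        rintro _ ⟨i, rfl⟩
        simp [RingHom.mem_ker]
      exact h ha)

/-- `Jₙ`, the ideal of `B n` generated by the `Sₙ`-invariant elements vanishing at the origin. -/
def Jn (n : ℕ) : Ideal (B n) :=
  Ideal.span {p : B n | (∀ σ : Equiv.Perm (Fin n), permB n σ p = p) ∧ ev0 n p = 0}

/-- the symmetric coinvariant algebra `Rₙ = Bₙ/Jₙ`. -/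
abbrev Rn (n : ℕ) : Type := B n ⧸ Jn n

/-- the filtration `F^p Bₙ = Σ_{|J|=p} y_J Bₙ`. -/
def FB (n p : ℕ) : Ideal (B n) :=
  Ideal.span {b | ∃ J : Finset (Fin n), J.card = p ∧ b = ∏ t ∈ J, yv n t}

/-- the subgroup `S_{n-m} ≤ Sₙ` of permutations fixing the first `m` letters. -/
def fixLT (n m : ℕ) : Subgroup (Equiv.Perm (Fin n)) where
  carrier := {σ | ∀ k : Fin n, (k : ℕ) < m → σ k = k}
  one_mem' := fun _ _ => rfl
  mul_mem' := by
    intro a b ha hb k hk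
    have : (a * b) k = a (b k) := rfl
    rw [this, hb k hk, ha k hk]
  inv_mem' := by
    intro a ha k hk
    have := ha k hk
    conv_lhs => rw [← this]
    exact a.symm_apply_apply k

/-- the left regular action of `Sₙ` on `ℂ[Sₙ]`, realized as functions on `Sₙ`. -/
def regAct (n : ℕ) (σ : Equiv.Perm (Fin n)) (f : Equiv.Perm (Fin n) → ℂ) :
    Equiv.Perm (Fin n) → ℂ := fun τ => f (σ⁻¹ * τ)

/-- the action of `Sₙ` on the permutation module `ℂ[Sₙ/S_{n-m}]`, realized as
functions on the coset space `Sₙ/S_{n-m}`. -/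
def cosetAct (n m : ℕ) (σ : Equiv.Perm (Fin n))
    (f : Equiv.Perm (Fin n) ⧸ fixLT n m → ℂ) :
    Equiv.Perm (Fin n) ⧸ fixLT n m → ℂ := fun x => f (σ⁻¹ • x)

/-- the ideal of `ℂ[x₁,…,xₙ]` generated by the symmetric polynomials with zero constant
term; the classical symmetric coinvariant algebra is the quotient by this ideal. -/
def classicalCoinvIdeal (n : ℕ) : Ideal (MvPolynomial (Fin n) ℂ) :=
  Ideal.span {P | (∀ σ : Equiv.Perm (Fin n), rename ⇑σ P = P) ∧ constantCoeff P = 0}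

section FiniteTower

variable {K A : Type*} [Field K] [CommRing A] [Algebra K A]

lemma finrank_le_mul_of_monic_root (S T : Subalgebra K A) [Module.Finite K S] (x : A)
    (f : Polynomial S) (hf : f.Monic) (hx : Polynomial.aeval x f = 0)
    (hT : ∀ t ∈ T, ∃ p : Polynomial S, Polynomial.aeval x p = t) :
    Module.Finite K T ∧ Module.finrank K T ≤ f.natDegree * Module.finrank K S := by
  let L : (Fin f.natDegree → S) →ₗ[K] A :=
    ∑ j : Fin f.natDegree,
      (LinearMap.mulRight K (x ^ (j : ℕ))) ∘ₗ S.val.toLinearMap ∘ₗ LinearMap.proj j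
  have hL : ∀ c, L c = ∑ j : Fin f.natDegree, (c j : A) * x ^ (j : ℕ) := fun c => by
    simp [L]
  have hle : Subalgebra.toSubmodule T ≤ LinearMap.range L := by
    intro t ht
    obtain ⟨p, rfl⟩ := hT t ht
    rw [← Polynomial.aeval_modByMonic_eq_self_of_root hx]
    by_cases h1 : f = 1
    · subst h1
      simp
    · refine ⟨fun j => (p %ₘ f).coeff j, ?_⟩
      rw [hL, Polynomial.aeval_eq_sum_range' (Polynomial.natDegree_modByMonic_lt p hf h1),
        ← Fin.sum_univ_eq_sum_range (fun i => (p %ₘ f).coeff i • x ^ i)]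
      rfl
  have hfin : Module.Finite K T :=
    Submodule.finiteDimensional_of_le (S₂ := LinearMap.range L) hle
  refine ⟨hfin, ?_⟩
  calc Module.finrank K T ≤ Module.finrank K (LinearMap.range L) := Submodule.finrank_mono hle
    _ ≤ Module.finrank K (Fin f.natDegree → S) := LinearMap.finrank_range_le L
    _ = f.natDegree * Module.finrank K S := by simp [Module.finrank_pi_fintype]

lemma finrank_adjoin_initial_le {n : ℕ} (x : Fin n → A)
    (hx : ∏ i, (Polynomial.X - Polynomial.C (x i)) = (Polynomial.X : Polynomial A) ^ n)
    (k : ℕ) (hk : k ≤ n) :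
    Module.Finite K (Algebra.adjoin K (x '' {i | (i : ℕ) < k})) ∧
      Module.finrank K (Algebra.adjoin K (x '' {i | (i : ℕ) < k})) * (n - k).factorial
        ≤ n.factorial := by
  induction k with
  | zero =>
    have h0 : Algebra.adjoin K (x '' {i | (i : ℕ) < 0}) = ⊥ := by simp
    rw [h0]
    have hs : Function.Surjective (Algebra.ofId K (⊥ : Subalgebra K A)).toLinearMap := by
      rintro ⟨a, ha⟩
      obtain ⟨c, rfl⟩ := Algebra.mem_bot.1 ha
      exact ⟨c, rfl⟩
    refine ⟨Module.Finite.of_surjective _ hs, ?_⟩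
    have := LinearMap.finrank_le_finrank_of_surjective hs
    rw [Module.finrank_self] at this
    simpa using Nat.mul_le_mul_right n.factorial this
  | succ k ih =>
    obtain ⟨hfin, hle⟩ := ih (by omega)
    set S := Algebra.adjoin K (x '' {i | (i : ℕ) < k}) with hS
    have hxS : ∀ i : Fin n, (i : ℕ) < k → x i ∈ S := fun i hi =>
      Algebra.subset_adjoin ⟨i, hi, rfl⟩
    let y : Fin n → S := fun i => if hi : (i : ℕ) < k then ⟨x i, hxS i hi⟩ else 0
    let s : Finset (Fin n) := Finset.univ.filter fun i => (i : ℕ) < k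
    let g : Polynomial S := ∏ i ∈ s, (Polynomial.X - Polynomial.C (y i))
    let h : Polynomial A := ∏ i ∈ sᶜ, (Polynomial.X - Polynomial.C (x i))
    have hg : g.Monic := Polynomial.monic_prod_of_monic _ _ fun i _ => Polynomial.monic_X_sub_C _
    have hh : h.Monic := Polynomial.monic_prod_of_monic _ _ fun i _ => Polynomial.monic_X_sub_C _
    have hgm : g.map (algebraMap S A) = ∏ i ∈ s, (Polynomial.X - Polynomial.C (x i)) := by
      rw [Polynomial.map_prod]
      refine Finset.prod_congr rfl fun i hi => ?_
      have hi' : (i : ℕ) < k := by simpa [s] using hi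
      simp [y, hi']
    have hgh : g.map (algebraMap S A) * h = Polynomial.X ^ n := by
      rw [hgm, ← hx]
      exact Finset.prod_mul_prod_compl s _
    let f : Polynomial S := Polynomial.X ^ n /ₘ g
    have hfm : f.map (algebraMap S A) = h := by
      rw [Polynomial.map_divByMonic _ hg, Polynomial.map_pow, Polynomial.map_X, ← hgh,
        Polynomial.mul_divByMonic_cancel_left _ (hg.map _)]
    have hinj : Function.Injective (algebraMap S A) := Subtype.val_injective
    have hf : f.Monic := Polynomial.monic_of_injective hinj (by rwa [hfm])
    have hroot : Polynomial.aeval (x ⟨k, hk⟩) f = 0 := by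
      rw [← Polynomial.eval_map_algebraMap, hfm, Polynomial.eval_prod]
      exact Finset.prod_eq_zero (i := ⟨k, hk⟩) (by simp [s]) (by simp)
    have hdeg : f.natDegree ≤ n - k := by
      have hc : s.card = k := by
        simpa [s, Fin.card_filter_val_lt] using Nat.le_of_succ_le hk
      rw [← Polynomial.natDegree_map_eq_of_injective hinj, hfm]
      refine (Polynomial.natDegree_prod_le _ _).trans ?_
      refine (Finset.sum_le_card_nsmul _ _ 1 fun i _ => Polynomial.natDegree_X_sub_C_le _).trans ?_
      simp [Finset.card_compl, hc]
    have key := finrank_le_mul_of_monic_root S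
      (Algebra.adjoin K (x '' {i | (i : ℕ) < k + 1})) (x ⟨k, hk⟩) f hf hroot (by
        have : Algebra.adjoin K (x '' {i | (i : ℕ) < k + 1}) ≤
            ((Polynomial.aeval (R := S) (x ⟨k, hk⟩)).restrictScalars K).range := by
          refine Algebra.adjoin_le ?_
          rintro _ ⟨i, hi, rfl⟩
          rcases Nat.lt_succ_iff_lt_or_eq.1 hi with hi | hi
          · exact ⟨Polynomial.C ⟨x i, hxS i hi⟩, by simp⟩
          · exact ⟨Polynomial.X, by simp [← hi]⟩
        exact fun t ht => this ht)
    refine ⟨key.1, ?_⟩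
    have e1 : n - k = (n - (k + 1)) + 1 := by omega
    calc _ ≤ ((n - k) * Module.finrank K S) * (n - (k + 1)).factorial :=
          Nat.mul_le_mul_right _ (key.2.trans (Nat.mul_le_mul_right _ hdeg))
      _ = Module.finrank K S * (n - k).factorial := by
          rw [e1, Nat.factorial_succ]; ring
      _ ≤ _ := hle

end FiniteTower

lemma rename_mem_classicalCoinvIdeal {n : ℕ} (σ : Equiv.Perm (Fin n))
    {p : MvPolynomial (Fin n) ℂ} (hp : p ∈ classicalCoinvIdeal n) :
    rename σ p ∈ classicalCoinvIdeal n := by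
  suffices h : classicalCoinvIdeal n ≤ (classicalCoinvIdeal n).comap (rename (R := ℂ) σ) from h hp
  refine Ideal.span_le.2 fun f hf => ?_
  rw [SetLike.mem_coe, Ideal.mem_comap, hf.1 σ]
  exact Ideal.subset_span hf

lemma prod_X_sub_C_coinvariants (n : ℕ) :
    ∏ i, (Polynomial.X - Polynomial.C (Ideal.Quotient.mk (classicalCoinvIdeal n) (X i))) =
      (Polynomial.X : Polynomial (MvPolynomial (Fin n) ℂ ⧸ classicalCoinvIdeal n)) ^ n := by
  let F : Polynomial (MvPolynomial (Fin n) ℂ) := ∏ i, (Polynomial.X - Polynomial.C (X i))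
  have hσ (σ : Equiv.Perm (Fin n)) : F.map (rename (R := ℂ) σ).toRingHom = F := by
    rw [Polynomial.map_prod]
    simpa using Equiv.prod_comp σ
      fun i => (Polynomial.X - Polynomial.C (X i) : Polynomial (MvPolynomial (Fin n) ℂ))
  have h0 : F.map constantCoeff = Polynomial.X ^ n := by
    rw [Polynomial.map_prod]
    simp
  have hmap : F.map (Ideal.Quotient.mk (classicalCoinvIdeal n)) =
      (Polynomial.X ^ n : Polynomial (MvPolynomial (Fin n) ℂ)).map
        (Ideal.Quotient.mk (classicalCoinvIdeal n)) := by
    ext k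
    rw [Polynomial.coeff_map, Polynomial.coeff_map, Ideal.Quotient.eq]
    refine Ideal.subset_span ⟨fun σ => ?_, ?_⟩
    · have h := congrArg (fun q => Polynomial.coeff q k) (hσ σ)
      simp only [Polynomial.coeff_map, AlgHom.toRingHom_eq_coe, RingHom.coe_coe] at h
      rw [map_sub, h, Polynomial.coeff_X_pow]
      split_ifs <;> simp
    · have h := congrArg (fun q => Polynomial.coeff q k) h0
      simp only [Polynomial.coeff_map] at h
      rw [map_sub, h, Polynomial.coeff_X_pow, Polynomial.coeff_X_pow]
      split_ifs <;> simp
  simpa [F, Polynomial.map_prod] using hmap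

lemma finrank_coinvariants_le (n : ℕ) :
    Module.Finite ℂ (MvPolynomial (Fin n) ℂ ⧸ classicalCoinvIdeal n) ∧
      Module.finrank ℂ (MvPolynomial (Fin n) ℂ ⧸ classicalCoinvIdeal n) ≤ n.factorial := by
  let x : Fin n → MvPolynomial (Fin n) ℂ ⧸ classicalCoinvIdeal n :=
    fun i => Ideal.Quotient.mkₐ ℂ _ (X i)
  obtain ⟨hfin, hle⟩ := finrank_adjoin_initial_le (K := ℂ) x (prod_X_sub_C_coinvariants n) n le_rfl
  have htop : Algebra.adjoin ℂ (x '' {i | (i : ℕ) < n}) = ⊤ := by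
    have h1 : x '' {i | (i : ℕ) < n} =
        Ideal.Quotient.mkₐ ℂ (classicalCoinvIdeal n) '' Set.range X := by
      rw [← Set.range_comp]
      simp [x, Function.comp_def]
    rw [h1, ← AlgHom.map_adjoin, adjoin_range_X, Algebra.map_top, AlgHom.range_eq_top]
    exact Ideal.Quotient.mkₐ_surjective _ _
  rw [htop] at hfin hle
  refine ⟨Module.Finite.equiv Subalgebra.topEquiv.toLinearEquiv, ?_⟩
  simpa [Subalgebra.topEquiv.toLinearEquiv.finrank_eq] using hle

/-- Evaluation of polynomials on the orbit of the point `(0, 1, …, n - 1)`. -/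
def orbitEval (n : ℕ) : MvPolynomial (Fin n) ℂ →ₐ[ℂ] (Equiv.Perm (Fin n) → ℂ) :=
  AlgHom.pi fun τ => aeval fun i => (((τ⁻¹ : Equiv.Perm (Fin n)) i : ℕ) : ℂ)

lemma orbitEval_apply {n : ℕ} (p : MvPolynomial (Fin n) ℂ) (τ : Equiv.Perm (Fin n)) :
    orbitEval n p τ = aeval (fun i => (((τ⁻¹ : Equiv.Perm (Fin n)) i : ℕ) : ℂ)) p := rfl

lemma orbitEval_rename {n : ℕ} (σ : Equiv.Perm (Fin n)) (p : MvPolynomial (Fin n) ℂ) :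
    orbitEval n (rename σ p) = regAct n σ (orbitEval n p) := by
  ext τ
  rw [regAct, orbitEval_apply, orbitEval_apply, aeval_rename]
  simp [Function.comp_def]

lemma orbitEval_of_symmetric {n : ℕ} {f : MvPolynomial (Fin n) ℂ}
    (hf : ∀ σ : Equiv.Perm (Fin n), rename σ f = f) :
    ∃ c : ℂ, orbitEval n f = algebraMap ℂ _ c := by
  refine ⟨orbitEval n f 1, funext fun τ => ?_⟩
  have h := congrFun (orbitEval_rename τ f) τ
  rw [hf τ] at h
  simpa [regAct] using h

lemma orbitEval_surjective (n : ℕ) : Function.Surjective (orbitEval n) := by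
  have hb (τ : Equiv.Perm (Fin n)) : ∃ p, orbitEval n p = Pi.single τ 1 := by
    let p : MvPolynomial (Fin n) ℂ := ∏ i, ∏ j ∈ Finset.univ.erase (τ⁻¹ i), (X i - C ((j : ℕ) : ℂ))
    have hp (ρ : Equiv.Perm (Fin n)) : orbitEval n p ρ =
        ∏ i, ∏ j ∈ Finset.univ.erase (τ⁻¹ i), ((((ρ⁻¹ i : Fin n) : ℕ) : ℂ) - ((j : ℕ) : ℂ)) := by
      simp [p, orbitEval_apply, map_prod]
    have hτ : orbitEval n p τ ≠ 0 := by
      rw [hp]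
      refine Finset.prod_ne_zero_iff.2 fun i _ => Finset.prod_ne_zero_iff.2 fun j hj => ?_
      rw [sub_ne_zero, Nat.cast_injective.ne_iff, Fin.val_injective.ne_iff]
      exact (Finset.ne_of_mem_erase hj).symm
    refine ⟨(orbitEval n p τ)⁻¹ • p, funext fun ρ => ?_⟩
    rw [map_smul, Pi.smul_apply]
    by_cases h : ρ = τ
    · subst h
      simp [hτ]
    · obtain ⟨i, hi⟩ : ∃ i, ρ⁻¹ i ≠ τ⁻¹ i := by
        by_contra! hc
        exact h (inv_injective (Equiv.ext hc))
      rw [Pi.single_eq_of_ne h, hp ρ, Finset.prod_eq_zero (Finset.mem_univ i), smul_zero]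
      exact Finset.prod_eq_zero (Finset.mem_erase.2 ⟨hi, Finset.mem_univ _⟩) (sub_self _)
  choose p hp using hb
  intro v
  refine ⟨∑ τ, v τ • p τ, ?_⟩
  simp only [map_sum, map_smul, hp]
  ext ρ
  simp [Finset.sum_apply, Pi.single_apply]

lemma homogeneousComponent_mul_of_isHomogeneous {σ R : Type*} [CommSemiring R]
    {a : MvPolynomial σ R} {i : ℕ} (ha : a.IsHomogeneous i) (f : MvPolynomial σ R) (d : ℕ) :
    homogeneousComponent d (a * f) = if i ≤ d then a * homogeneousComponent (d - i) f else 0 := by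
  conv_lhs => rw [← sum_homogeneousComponent f, Finset.mul_sum, map_sum]
  have h (j : ℕ) : homogeneousComponent d (a * homogeneousComponent j f) =
      if d = i + j then a * homogeneousComponent j f else 0 :=
    homogeneousComponent_of_mem ((mem_homogeneousSubmodule _ _).2
      (ha.mul (homogeneousComponent_isHomogeneous j f)))
  simp only [h]
  split_ifs with hid
  · obtain ⟨k, rfl⟩ := Nat.exists_eq_add_of_le hid
    simp only [add_right_inj, Finset.sum_ite_eq, Finset.mem_range, Nat.add_sub_cancel_left]
    split_ifs with hk
    · rfl
    · rw [homogeneousComponent_eq_zero k f (by omega), mul_zero]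
  · exact Finset.sum_eq_zero fun j _ => if_neg (by omega)

lemma homogeneousComponent_mem_classicalCoinvIdeal {n : ℕ} (d : ℕ)
    {p : MvPolynomial (Fin n) ℂ} (hp : p ∈ classicalCoinvIdeal n) :
    homogeneousComponent d p ∈ classicalCoinvIdeal n ∧
      ∃ r : MvPolynomial (Fin n) ℂ, (∀ k, d ≤ k → homogeneousComponent k r = 0) ∧
        orbitEval n (homogeneousComponent d p) = orbitEval n r := by
  let good (p : MvPolynomial (Fin n) ℂ) : Prop :=
    homogeneousComponent d p ∈ classicalCoinvIdeal n ∧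
      ∃ r : MvPolynomial (Fin n) ℂ, (∀ k, d ≤ k → homogeneousComponent k r = 0) ∧
        orbitEval n (homogeneousComponent d p) = orbitEval n r
  change good p
  have hmul : ∀ (i : ℕ) (a f : MvPolynomial (Fin n) ℂ), a.IsHomogeneous i →
      (∀ σ : Equiv.Perm (Fin n), rename σ f = f) → constantCoeff f = 0 →
      good (a * f) := by
    intro i a f ha hf hf0
    unfold good
    rw [homogeneousComponent_mul_of_isHomogeneous ha]
    split_ifs with hid
    · have hsym (σ : Equiv.Perm (Fin n)) :
          rename σ (homogeneousComponent (d - i) f) = homogeneousComponent (d - i) f := by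
        rw [rename_homogeneousComponent, hf σ]
      rcases hid.eq_or_lt with rfl | hlt
      · have h0 : homogeneousComponent (i - i) f = 0 := by
          rw [Nat.sub_self, homogeneousComponent_zero]
          rw [constantCoeff_eq] at hf0
          rw [hf0, C_0]
        rw [h0, mul_zero]
        exact ⟨zero_mem _, 0, by simp, rfl⟩
      · refine ⟨Ideal.mul_mem_left _ _ (Ideal.subset_span ⟨hsym, ?_⟩), ?_⟩
        · rw [constantCoeff_eq, coeff_homogeneousComponent, if_neg]
          simp only [map_zero]
          omega
        · obtain ⟨c, hc⟩ := orbitEval_of_symmetric hsym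
          refine ⟨c • a, fun k hk => ?_, ?_⟩
          · rw [map_smul, homogeneousComponent_of_mem ((mem_homogeneousSubmodule _ _).2 ha),
              if_neg (by omega), smul_zero]
          · rw [map_mul, hc, map_smul, mul_comm, Algebra.smul_def]
    · exact ⟨zero_mem _, 0, by simp, rfl⟩
  have hadd : ∀ p q, good p → good q → good (p + q) := by
    rintro p q ⟨hp, r, hr, hpr⟩ ⟨hq, s, hs, hqs⟩
    refine ⟨by rw [map_add]; exact add_mem hp hq, r + s, fun k hk => ?_, ?_⟩
    · rw [map_add, hr k hk, hs k hk, add_zero]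
    · rw [map_add, map_add, map_add, hpr, hqs]
  induction hp using Submodule.closure_induction with
  | zero => exact ⟨by simp, 0, by simp, by simp⟩
  | add p q _ _ hp hq => exact hadd p q hp hq
  | smul_mem a f hf =>
    rw [smul_eq_mul]
    induction a using MvPolynomial.induction_on' with
    | monomial m c => exact hmul m.degree _ f (isHomogeneous_monomial _ rfl) hf.1 hf.2
    | add p q hp hq =>
      rw [add_mul]
      exact hadd _ _ hp hq

/-- A linear endomorphism of the polynomial ring preserving degrees, killing `I`, and the
identity modulo `I`. -/
lemma exists_graded_section {σ K : Type*} [Field K] (I : Ideal (MvPolynomial σ K))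
    (hI : ∀ p ∈ I, ∀ d, homogeneousComponent d p ∈ I) :
    ∃ q : MvPolynomial σ K →ₗ[K] MvPolynomial σ K,
      (∀ p ∈ I, q p = 0) ∧ (∀ p, p - q p ∈ I) ∧
      ∀ d p, p.IsHomogeneous d → (q p).IsHomogeneous d := by
  let N (d : ℕ) : Submodule K (MvPolynomial σ K) :=
    I.restrictScalars K ⊓ homogeneousSubmodule σ K d
  have hN (d : ℕ) := (N d).subtype.exists_leftInverse_of_injective (N d).ker_subtype
  choose g hg using hN
  have hg' (d : ℕ) (p) (hp : p ∈ N d) : (g d p : MvPolynomial σ K) = p :=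
    congrArg Subtype.val (LinearMap.congr_fun (hg d) ⟨p, hp⟩)
  let π : MvPolynomial σ K →ₗ[K] MvPolynomial σ K :=
    (basisMonomials σ K).constr K fun m => (g m.degree (monomial m 1) : MvPolynomial σ K)
  have hmon (m : σ →₀ ℕ) : π (monomial m 1) = g m.degree (monomial m 1) := by
    have := (basisMonomials σ K).constr_basis K
      (fun m => (g m.degree (monomial m 1) : MvPolynomial σ K)) m
    rwa [coe_basisMonomials] at this
  have hπ (d : ℕ) (p : MvPolynomial σ K) (hp : p.IsHomogeneous d) : π p = g d p := by
    conv_lhs => rw [p.as_sum]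
    conv_rhs => rw [p.as_sum]
    rw [map_sum, map_sum, AddSubmonoidClass.coe_finsetSum]
    refine Finset.sum_congr rfl fun m hm => ?_
    have hd : m.degree = d := by
      by_contra h
      exact mem_support_iff.1 hm (hp.coeff_eq_zero h)
    have hc : monomial m (coeff m p) = coeff m p • monomial m (1 : K) := by
      rw [smul_monomial, smul_eq_mul, mul_one]
    rw [hc, map_smul, map_smul, hmon, hd]
    rfl
  have hsum (p : MvPolynomial σ K) : π p =
      ∑ d ∈ Finset.range (p.totalDegree + 1), (g d (homogeneousComponent d p) : MvPolynomial σ K) := by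
    conv_lhs => rw [← sum_homogeneousComponent p, map_sum]
    exact Finset.sum_congr rfl fun d _ => hπ d _ (homogeneousComponent_isHomogeneous d p)
  refine ⟨LinearMap.id - π, fun p hp => ?_, fun p => ?_, fun d p hp => ?_⟩
  · rw [LinearMap.sub_apply, LinearMap.id_apply, sub_eq_zero, hsum]
    conv_lhs => rw [← sum_homogeneousComponent p]
    exact Finset.sum_congr rfl fun d _ => (hg' d _
      ⟨hI p hp d, (mem_homogeneousSubmodule _ _).2 (homogeneousComponent_isHomogeneous d p)⟩).symm
  · rw [LinearMap.sub_apply, LinearMap.id_apply, sub_sub_cancel, hsum]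
    exact sum_mem fun d _ => (g d _).2.1
  · rw [LinearMap.sub_apply, LinearMap.id_apply, hπ d p hp]
    exact hp.sub ((mem_homogeneousSubmodule _ _).1 (g d p).2.2)

lemma exists_equivariant_graded_section (n : ℕ) :
    ∃ q : MvPolynomial (Fin n) ℂ →ₗ[ℂ] MvPolynomial (Fin n) ℂ,
      (∀ p ∈ classicalCoinvIdeal n, q p = 0) ∧ (∀ p, p - q p ∈ classicalCoinvIdeal n) ∧
      (∀ d p, p.IsHomogeneous d → (q p).IsHomogeneous d) ∧
      ∀ (σ : Equiv.Perm (Fin n)) p, q (rename σ p) = rename σ (q p) := by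
  obtain ⟨q, hq0, hqI, hqd⟩ := exists_graded_section (classicalCoinvIdeal n)
    fun p hp d => (homogeneousComponent_mem_classicalCoinvIdeal d hp).1
  let c : ℂ := (Fintype.card (Equiv.Perm (Fin n)) : ℂ)
  have hc : c ≠ 0 := Nat.cast_ne_zero.2 Fintype.card_ne_zero
  let Q : MvPolynomial (Fin n) ℂ →ₗ[ℂ] MvPolynomial (Fin n) ℂ :=
    c⁻¹ • ∑ τ : Equiv.Perm (Fin n), (rename (τ : Fin n → Fin n)).toLinearMap ∘ₗ q ∘ₗ
      (rename ((τ⁻¹ : Equiv.Perm (Fin n)) : Fin n → Fin n)).toLinearMap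
  have hQ (p) : Q p = c⁻¹ • ∑ τ : Equiv.Perm (Fin n),
      rename τ (q (rename (τ⁻¹ : Equiv.Perm (Fin n)) p)) := by
    simp [Q]
  refine ⟨Q, fun p hp => ?_, fun p => ?_, fun d p hp => ?_, fun σ p => ?_⟩
  · rw [hQ, Finset.sum_eq_zero, smul_zero]
    intro τ _
    rw [hq0 _ (rename_mem_classicalCoinvIdeal _ hp), map_zero]
  · have hp : p = c⁻¹ • ∑ τ : Equiv.Perm (Fin n),
        rename τ (rename (τ⁻¹ : Equiv.Perm (Fin n)) p) := by
      have (τ : Equiv.Perm (Fin n)) : rename τ (rename (τ⁻¹ : Equiv.Perm (Fin n)) p) = p := by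
        rw [rename_rename, ← Equiv.Perm.coe_mul, mul_inv_cancel, Equiv.Perm.coe_one, rename_id_apply]
      simp only [this, Finset.sum_const, Finset.card_univ]
      rw [← Nat.cast_smul_eq_nsmul ℂ, smul_smul, inv_mul_cancel₀ hc, one_smul]
    rw [hQ]
    nth_rw 1 [hp]
    rw [← smul_sub, ← Finset.sum_sub_distrib]
    refine Submodule.smul_of_tower_mem _ _ (sum_mem fun τ _ => ?_)
    rw [← map_sub]
    exact rename_mem_classicalCoinvIdeal _ (hqI _)
  · rw [hQ, ← mem_homogeneousSubmodule]
    refine Submodule.smul_mem _ _ (sum_mem fun τ _ => ?_)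
    rw [mem_homogeneousSubmodule]
    exact (hqd d _ hp.rename_isHomogeneous).rename_isHomogeneous
  · rw [hQ, hQ, map_smul, map_sum, ← Equiv.sum_comp (Equiv.mulLeft σ)]
    congr 1
    refine Finset.sum_congr rfl fun τ _ => ?_
    rw [rename_rename, rename_rename, Equiv.coe_mulLeft, Equiv.Perm.coe_mul,
      ← Equiv.Perm.coe_mul _ σ, mul_inv_rev, inv_mul_cancel_right]

lemma exists_coinvariants_equiv_regular (n : ℕ) :
    ∃ e : (MvPolynomial (Fin n) ℂ ⧸ classicalCoinvIdeal n) ≃ₗ[ℂ] (Equiv.Perm (Fin n) → ℂ),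
      ∀ (σ : Equiv.Perm (Fin n)) (p : MvPolynomial (Fin n) ℂ),
        e (Ideal.Quotient.mk _ (rename σ p)) = regAct n σ (e (Ideal.Quotient.mk _ p)) := by
  obtain ⟨q, hq0, hqI, hqd, hqσ⟩ := exists_equivariant_graded_section n
  let L : MvPolynomial (Fin n) ℂ →ₗ[ℂ] (Equiv.Perm (Fin n) → ℂ) :=
    (orbitEval n).toLinearMap ∘ₗ q
  have hL (p) : L p = orbitEval n (q p) := rfl
  have hhom (d : ℕ) : ∀ p : MvPolynomial (Fin n) ℂ, p.IsHomogeneous d →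
      orbitEval n p ∈ LinearMap.range L := by
    induction d using Nat.strong_induction_on with
    | _ d ih =>
      intro p hp
      obtain ⟨-, r, hr, hpr⟩ := homogeneousComponent_mem_classicalCoinvIdeal d (hqI p)
      rw [homogeneousComponent_eq_self (hp.sub (hqd d p hp))] at hpr
      have hr' : orbitEval n r ∈ LinearMap.range L := by
        rw [← sum_homogeneousComponent r, map_sum]
        refine sum_mem fun k _ => ?_
        by_cases hk : d ≤ k
        · rw [hr k hk, map_zero]
          exact zero_mem _
        · exact ih k (by omega) _ (homogeneousComponent_isHomogeneous k r)
      have : orbitEval n p = orbitEval n r + L p := by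
        rw [← hpr, map_sub, hL, sub_add_cancel]
      rw [this]
      exact add_mem hr' ⟨p, rfl⟩
  have hLs : Function.Surjective L := by
    intro v
    obtain ⟨p, rfl⟩ := orbitEval_surjective n v
    rw [← sum_homogeneousComponent p, map_sum]
    exact sum_mem fun k _ => hhom k _ (homogeneousComponent_isHomogeneous k p)
  let E : (MvPolynomial (Fin n) ℂ ⧸ classicalCoinvIdeal n) →ₗ[ℂ] (Equiv.Perm (Fin n) → ℂ) :=
    Submodule.liftQ ((classicalCoinvIdeal n).restrictScalars ℂ) L fun p hp => by
      rw [LinearMap.mem_ker, hL, hq0 p hp, map_zero]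
  have hE (p) : E (Ideal.Quotient.mk _ p) = L p := rfl
  have hEs : Function.Surjective E := fun v => by
    obtain ⟨p, rfl⟩ := hLs v
    exact ⟨Ideal.Quotient.mk _ p, rfl⟩
  obtain ⟨hfin, hle⟩ := finrank_coinvariants_le n
  have hdim : Module.finrank ℂ (Equiv.Perm (Fin n) → ℂ) = n.factorial := by
    rw [Module.finrank_fintype_fun_eq_card, Fintype.card_perm, Fintype.card_fin]
  have heq : Module.finrank ℂ (MvPolynomial (Fin n) ℂ ⧸ classicalCoinvIdeal n) =
      Module.finrank ℂ (Equiv.Perm (Fin n) → ℂ) :=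
    le_antisymm (hle.trans hdim.ge) (LinearMap.finrank_le_finrank_of_surjective hEs)
  refine ⟨LinearEquiv.ofBijective E
    ⟨(LinearMap.injective_iff_surjective_of_finrank_eq_finrank heq).2 hEs, hEs⟩, fun σ p => ?_⟩
  change E _ = regAct n σ (E _)
  rw [hE, hE, hL, hL, hqσ, orbitEval_rename]

/-- The projection `B n → ℂ[x₁,…,xₙ]` setting all `yᵢ` to zero. -/
def projX (n : ℕ) : B n →ₐ[ℂ] MvPolynomial (Fin n) ℂ :=
  Ideal.Quotient.liftₐ (Bideal n) (aeval (Sum.elim X 0)) (by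
    intro a ha
    have h : Bideal n ≤ RingHom.ker (aeval (R := ℂ)
        (Sum.elim X 0 : Fin n ⊕ Fin n → MvPolynomial (Fin n) ℂ)).toRingHom := by
      rw [Ideal.span_le]
      rintro _ ⟨i, rfl⟩
      simp [RingHom.mem_ker]
    exact h ha)

lemma projX_mkB {n : ℕ} (p : MvPolynomial (Fin n ⊕ Fin n) ℂ) :
    projX n (mkB n p) = aeval (Sum.elim X 0) p := rfl

lemma permB_mkB {n : ℕ} (σ : Equiv.Perm (Fin n)) (p : MvPolynomial (Fin n ⊕ Fin n) ℂ) :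
    permB n σ (mkB n p) = mkB n (rename (Sum.map σ σ) p) := rfl

lemma ev0_mkB {n : ℕ} (p : MvPolynomial (Fin n ⊕ Fin n) ℂ) :
    ev0 n (mkB n p) = aeval (fun _ => (0 : ℂ)) p := rfl

lemma projX_yv {n : ℕ} (i : Fin n) : projX n (yv n i) = 0 := by
  rw [yv, projX_mkB, aeval_X, Sum.elim_inr, Pi.zero_apply]

lemma projX_permB {n : ℕ} (σ : Equiv.Perm (Fin n)) (b : B n) :
    projX n (permB n σ b) = rename σ (projX n b) := by
  obtain ⟨p, rfl⟩ := Ideal.Quotient.mkₐ_surjective ℂ (Bideal n) b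
  rw [permB_mkB, projX_mkB, projX_mkB, aeval_rename, ← AlgHom.comp_apply, comp_aeval]
  congr 2
  ext (i | i) <;> simp

lemma constantCoeff_projX {n : ℕ} (b : B n) : constantCoeff (projX n b) = ev0 n b := by
  obtain ⟨p, rfl⟩ := Ideal.Quotient.mkₐ_surjective ℂ (Bideal n) b
  rw [projX_mkB, ev0_mkB]
  induction p using MvPolynomial.induction_on with
  | C a => simp
  | add p q hp hq => simp only [map_add, hp, hq]
  | mul_X p i _ => cases i <;> simp

/-- The inclusion `ℂ[x₁,…,xₙ] → B n`. -/
def inclX (n : ℕ) : MvPolynomial (Fin n) ℂ →ₐ[ℂ] B n := (mkB n).comp (rename Sum.inl)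

lemma projX_inclX {n : ℕ} (p : MvPolynomial (Fin n) ℂ) : projX n (inclX n p) = p := by
  rw [inclX, AlgHom.comp_apply, projX_mkB, aeval_rename]
  simp

lemma permB_inclX {n : ℕ} (σ : Equiv.Perm (Fin n)) (p : MvPolynomial (Fin n) ℂ) :
    permB n σ (inclX n p) = inclX n (rename σ p) := by
  simp only [inclX, AlgHom.comp_apply, permB_mkB, rename_rename]
  rfl

lemma sub_inclX_projX_mem {n : ℕ} (b : B n) : b - inclX n (projX n b) ∈ FB n 1 := by
  obtain ⟨p, rfl⟩ := Ideal.Quotient.mkₐ_surjective ℂ (Bideal n) b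
  have h : (Ideal.Quotient.mkₐ ℂ (FB n 1)).comp (mkB n) =
      (Ideal.Quotient.mkₐ ℂ (FB n 1)).comp ((inclX n).comp ((projX n).comp (mkB n))) := by
    ext (i | i)
    · simp only [AlgHom.comp_apply, projX_mkB, aeval_X, Sum.elim_inl, inclX, rename_X]
    · simp only [AlgHom.comp_apply, projX_mkB, aeval_X, Sum.elim_inr, Pi.zero_apply, map_zero]
      refine Ideal.Quotient.eq_zero_iff_mem.2 (Ideal.subset_span ⟨{i}, by simp, ?_⟩)
      rw [Finset.prod_singleton, yv]
  exact Ideal.Quotient.eq.1 (AlgHom.congr_fun h p)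

lemma projX_mem_of_mem {n : ℕ} {b : B n} (hb : b ∈ Jn n ⊔ FB n 1) :
    projX n b ∈ classicalCoinvIdeal n := by
  suffices h : Jn n ⊔ FB n 1 ≤ (classicalCoinvIdeal n).comap (projX n) from h hb
  refine sup_le (Ideal.span_le.2 ?_) (Ideal.span_le.2 ?_)
  · rintro f ⟨hf, hf0⟩
    refine Ideal.subset_span ⟨fun σ => ?_, ?_⟩
    · rw [← projX_permB, hf σ]
    · rw [constantCoeff_projX, hf0]
  · rintro _ ⟨J, hJ, rfl⟩
    obtain ⟨i, rfl⟩ := Finset.card_eq_one.1 hJ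
    rw [SetLike.mem_coe, Ideal.mem_comap, Finset.prod_singleton, projX_yv]
    exact zero_mem _

lemma inclX_mem_of_mem {n : ℕ} {p : MvPolynomial (Fin n) ℂ} (hp : p ∈ classicalCoinvIdeal n) :
    inclX n p ∈ Jn n ⊔ FB n 1 := by
  suffices h : classicalCoinvIdeal n ≤ (Jn n).comap (inclX n) from
    Ideal.mem_sup_left (h hp)
  refine Ideal.span_le.2 fun f hf => Ideal.subset_span ⟨fun σ => ?_, ?_⟩
  · rw [permB_inclX, hf.1 σ]
  · rw [← constantCoeff_projX, projX_inclX, hf.2]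

/-- `Bₙ/(Jₙ + F¹Bₙ)` is the classical coinvariant algebra. -/
def degreeZeroEquiv (n : ℕ) :
    (B n ⧸ (Jn n ⊔ FB n 1)) ≃ₐ[ℂ] (MvPolynomial (Fin n) ℂ ⧸ classicalCoinvIdeal n) :=
  AlgEquiv.ofBijective
    (Ideal.Quotient.liftₐ _ ((Ideal.Quotient.mkₐ ℂ (classicalCoinvIdeal n)).comp (projX n))
      fun _ hb => Ideal.Quotient.eq_zero_iff_mem.2 (projX_mem_of_mem hb)) (by
    constructor
    · rw [injective_iff_map_eq_zero]
      intro x hx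
      obtain ⟨b, rfl⟩ := Ideal.Quotient.mk_surjective x
      have hb : projX n b ∈ classicalCoinvIdeal n := Ideal.Quotient.eq_zero_iff_mem.1 hx
      rw [Ideal.Quotient.eq_zero_iff_mem, ← sub_add_cancel b (inclX n (projX n b))]
      exact add_mem (Ideal.mem_sup_right (sub_inclX_projX_mem b)) (inclX_mem_of_mem hb)
    · intro x
      obtain ⟨p, rfl⟩ := Ideal.Quotient.mk_surjective x
      exact ⟨Ideal.Quotient.mk _ (inclX n p), congrArg (Ideal.Quotient.mk _) (projX_inclX p)⟩)

lemma degreeZeroEquiv_mk {n : ℕ} (b : B n) :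
    degreeZeroEquiv n (Ideal.Quotient.mk _ b) = Ideal.Quotient.mk _ (projX n b) := rfl

/-- For every `n ≥ 1`, the degree-zero graded piece
`Rₙ^{(0)} = Bₙ/(Jₙ + F¹Bₙ)` is isomorphic, as an `Sₙ`-algebra, to the classical
symmetric coinvariant algebra `ℂ[x₁,…,xₙ]_{Sₙ}`; in particular it is isomorphic as a
`ℂ[Sₙ]`-module to the regular representation `ℂ[Sₙ]`. -/
theorem degree_zero_piece_is_classical_coinvariants (n : ℕ) (hn : 1 ≤ n) :
    (∃ e : (B n ⧸ (Jn n ⊔ FB n 1)) ≃ₐ[ℂ]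
        (MvPolynomial (Fin n) ℂ ⧸ classicalCoinvIdeal n),
      ∀ (σ : Equiv.Perm (Fin n)) (P : B n) (Q : MvPolynomial (Fin n) ℂ),
        e (Ideal.Quotient.mk (Jn n ⊔ FB n 1) P) =
          Ideal.Quotient.mk (classicalCoinvIdeal n) Q →
        e (Ideal.Quotient.mk (Jn n ⊔ FB n 1) (permB n σ P)) =
          Ideal.Quotient.mk (classicalCoinvIdeal n) (rename ⇑σ Q)) ∧
    ∃ e' : (B n ⧸ (Jn n ⊔ FB n 1)) ≃ₗ[ℂ] (Equiv.Perm (Fin n) → ℂ),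
      ∀ (σ : Equiv.Perm (Fin n)) (P : B n),
        e' (Ideal.Quotient.mk (Jn n ⊔ FB n 1) (permB n σ P)) =
          regAct n σ (e' (Ideal.Quotient.mk (Jn n ⊔ FB n 1) P)) := by
  obtain ⟨E, hE⟩ := exists_coinvariants_equiv_regular n
  refine ⟨⟨degreeZeroEquiv n, fun σ P Q h => ?_⟩,
    (degreeZeroEquiv n).toLinearEquiv.trans E, fun σ P => ?_⟩
  · rw [degreeZeroEquiv_mk, Ideal.Quotient.eq] at h ⊢
    rw [projX_permB, ← map_sub]
    exact rename_mem_classicalCoinvIdeal σ h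
  · simp only [LinearEquiv.trans_apply, AlgEquiv.toLinearEquiv_apply, degreeZeroEquiv_mk,
      projX_permB, hE]

end
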